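/- Let F = (V,E) be a forest and V' ⊆ V. There is a constant k (independent of F) and a partition (A,B,C) of V such that |A| ≤ 2|V|/3, |B| ≤ 2|V|/3, |V'∩A| ≤ 2|V'|/3, |V'∩B| ≤ 2|V'|/3, |C| ≤ k, and every path from a vertex of A to a vertex of B passes through a vertex of C. In fact one may take k = 2 (removing at most 2 vertices suffices). -/

import Mathlib

open Finset

namespace ForestSeparator

section Packing

variable {ι : Type*} [DecidableEq ι]

/-- Items of size at most `2N/3 - q` can be packed into three bins, two of capacity `2N/3 - q` and
one of capacity `2N/3` that initially holds `m`; only the first two bins are named. -/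
theorem exists_three_bins (f : ι → ℕ) {m q N : ℕ} (hq : 3 * q ≤ N) (hm : 3 * m ≤ 2 * N)
    (s : Finset ι) (hf : ∀ i ∈ s, 3 * (f i + q) ≤ 2 * N) (htot : m + ∑ i ∈ s, f i ≤ N) :
    ∃ I J, I ⊆ s ∧ J ⊆ s ∧ Disjoint I J ∧ 3 * (∑ i ∈ I, f i + q) ≤ 2 * N ∧
      3 * (∑ i ∈ J, f i + q) ≤ 2 * N ∧
      3 * (m + ∑ i ∈ s, f i) ≤ 2 * N + 3 * (∑ i ∈ I, f i + ∑ i ∈ J, f i) := by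
  induction s using Finset.induction_on with
  | empty => exact ⟨∅, ∅, by simp, by simp, by simp, by simp; omega, by simp; omega, by simpa⟩
  | insert e s he ih =>
    rw [sum_insert he] at htot ⊢
    obtain ⟨I, J, hI, hJ, hIJ, h1, h2, h3⟩ :=
      ih (fun i hi => hf i (mem_insert_of_mem hi)) (by omega)
    have hfe := hf e (mem_insert_self e s)
    have heI : e ∉ I := fun h => he (hI h)
    have heJ : e ∉ J := fun h => he (hJ h)
    have hs := subset_insert e s
    by_cases c1 : 3 * (f e + ∑ i ∈ I, f i + q) ≤ 2 * N
    · refine ⟨insert e I, J, insert_subset_insert e hI, hJ.trans hs,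
        disjoint_insert_left.2 ⟨heJ, hIJ⟩, ?_, h2, ?_⟩ <;> rw [sum_insert heI] <;> omega
    by_cases c2 : 3 * (f e + ∑ i ∈ J, f i + q) ≤ 2 * N
    · refine ⟨I, insert e J, hI.trans hs, insert_subset_insert e hJ,
        disjoint_insert_right.2 ⟨heI, hIJ⟩, h1, ?_, ?_⟩ <;> rw [sum_insert heJ] <;> omega
    · refine ⟨{e}, J, by simp, hJ.trans hs, by simpa using heJ, ?_, h2, ?_⟩ <;>
        rw [sum_singleton] <;> omega

theorem exists_subset_forall_not_erase {p : Finset ι → Prop} (s : Finset ι) (hs : p s) :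
    ∃ t ⊆ s, p t ∧ ∀ i ∈ t, ¬ p (t.erase i) := by
  induction s using Finset.strongInduction with
  | H s ih =>
    by_cases h : ∀ i ∈ s, ¬ p (s.erase i)
    · exact ⟨s, Subset.rfl, hs, h⟩
    · push Not at h
      obtain ⟨i, hi, hp⟩ := h
      obtain ⟨t, ht, h⟩ := ih _ (erase_ssubset hi) hp
      exact ⟨t, ht.trans (erase_subset _ _), h⟩

theorem three_mul_sum_le_of_erase (f : ι → ℕ) {N : ℕ} (s : Finset ι)
    (hf : ∀ i ∈ s, 3 * f i ≤ 2 * N) (h : ∀ i ∈ s, 3 * ∑ j ∈ s.erase i, f j < N) :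
    3 * ∑ i ∈ s, f i ≤ 2 * N := by
  rcases s.eq_empty_or_nonempty with rfl | ⟨i, hi⟩
  · simp
  by_cases hj : ∃ j ∈ s, j ≠ i
  · obtain ⟨j, hj, hji⟩ := hj
    have h1 := h i hi
    have h2 := h j hj
    have h3 := add_sum_erase s f hj
    have h4 := single_le_sum (f := f) (fun _ _ => Nat.zero_le _) (mem_erase.2 ⟨hji, hj⟩)
    omega
  · push Not at hj
    have : s = {i} := by ext k; simp only [mem_singleton]; exact ⟨hj k, fun h => h ▸ hi⟩
    simpa [this] using hf i hi

theorem balanced_or_opposite_of_heavy (f g : ι → ℕ) {N M : ℕ} {s t : Finset ι}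
    (hf : ∀ i ∈ s, 3 * f i ≤ 2 * N) (hfs : ∑ i ∈ s, f i ≤ N) (hgs : ∑ i ∈ s, g i ≤ M)
    (ht : t ⊆ s) (hft : 3 * ∑ i ∈ t, f i ≤ 2 * N) (hgt : 3 * ∑ i ∈ t, g i ≤ 2 * M)
    (hM : M ≤ 3 * ∑ i ∈ t, g i) :
    (∃ I ⊆ s, 3 * ∑ i ∈ I, f i ≤ 2 * N ∧ 3 * ∑ i ∈ I, g i ≤ 2 * M ∧
      3 * ∑ i ∈ s \ I, f i ≤ 2 * N ∧ 3 * ∑ i ∈ s \ I, g i ≤ 2 * M) ∨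
    ∃ I J, I ⊆ s ∧ J ⊆ s ∧ Disjoint I J ∧ N ≤ 3 * ∑ i ∈ I, f i ∧ 3 * ∑ i ∈ I, g i ≤ M ∧
      M ≤ 3 * ∑ i ∈ J, g i ∧ 3 * ∑ i ∈ J, f i ≤ N := by
  have e1 := sum_sdiff (f := f) ht
  have e2 := sum_sdiff (f := g) ht
  by_cases c1 : 3 * ∑ i ∈ s \ t, f i ≤ 2 * N
  · exact .inl ⟨t, ht, hft, hgt, c1, by omega⟩
  obtain ⟨u, hu, hNu, hmin⟩ := exists_subset_forall_not_erase
    (p := fun u => N ≤ 3 * ∑ i ∈ u, f i) (s \ t) (by omega)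
  have hus : u ⊆ s := hu.trans sdiff_subset
  have hfu := three_mul_sum_le_of_erase f u (fun i hi => hf i (hus hi))
    (fun i hi => not_le.1 (hmin i hi))
  have e3 := sum_sdiff (f := f) hus
  have e4 := sum_sdiff (f := g) hus
  have e5 := sum_le_sum_of_subset (f := g) hu
  by_cases c2 : 3 * ∑ i ∈ u, g i ≤ M
  · refine .inr ⟨u, t, hus, ht, disjoint_of_subset_left hu sdiff_disjoint, hNu, c2, hM, ?_⟩
    omega
  · exact .inl ⟨u, hus, hfu, by omega, by omega, by omega⟩

/-- Items carrying two sizes, each at most two thirds of the respective total, either split evenly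
with respect to both sizes, or contain two disjoint groups of opposite types. -/
theorem balanced_or_opposite (f g : ι → ℕ) {N M : ℕ} {s : Finset ι}
    (hf : ∀ i ∈ s, 3 * f i ≤ 2 * N) (hg : ∀ i ∈ s, 3 * g i ≤ 2 * M)
    (hfs : ∑ i ∈ s, f i ≤ N) (hgs : ∑ i ∈ s, g i ≤ M) :
    (∃ I ⊆ s, 3 * ∑ i ∈ I, f i ≤ 2 * N ∧ 3 * ∑ i ∈ I, g i ≤ 2 * M ∧
      3 * ∑ i ∈ s \ I, f i ≤ 2 * N ∧ 3 * ∑ i ∈ s \ I, g i ≤ 2 * M) ∨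
    ∃ I J, I ⊆ s ∧ J ⊆ s ∧ Disjoint I J ∧ N ≤ 3 * ∑ i ∈ I, f i ∧ 3 * ∑ i ∈ I, g i ≤ M ∧
      M ≤ 3 * ∑ i ∈ J, g i ∧ 3 * ∑ i ∈ J, f i ≤ N := by
  by_cases c : N ≤ 3 * ∑ i ∈ s, f i ∨ M ≤ 3 * ∑ i ∈ s, g i
  · obtain ⟨t, ht, hNM, hmin⟩ := exists_subset_forall_not_erase
      (p := fun u => N ≤ 3 * ∑ i ∈ u, f i ∨ M ≤ 3 * ∑ i ∈ u, g i) s c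
    push Not at hmin
    have hft := three_mul_sum_le_of_erase f t (fun i hi => hf i (ht hi))
      (fun i hi => (hmin i hi).1)
    have hgt := three_mul_sum_le_of_erase g t (fun i hi => hg i (ht hi))
      (fun i hi => (hmin i hi).2)
    rcases hNM with hN | hM
    · rcases balanced_or_opposite_of_heavy g f hg hgs hfs ht hgt hft hN with
        ⟨I, hI, h1, h2, h3, h4⟩ | ⟨I, J, hI, hJ, hIJ, h1, h2, h3, h4⟩
      · exact .inl ⟨I, hI, h2, h1, h4, h3⟩
      · exact .inr ⟨J, I, hJ, hI, hIJ.symm, h3, h4, h1, h2⟩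
    · exact balanced_or_opposite_of_heavy f g hf hfs hgs ht hft hgt hM
  · exact .inl ⟨s, Subset.rfl, by omega, by omega, by simp, by simp⟩

end Packing

section Graph

theorem reachable_induction {V : Type*} {H : SimpleGraph V} {p : V → Prop} {u w : V} 
    (hr : H.Reachable u w) (hu : p u)
    (step : ∀ x y, H.Reachable u x → p x → H.Adj x y → p y) : p w := by
  rw [SimpleGraph.reachable_iff_reflTransGen] at hr
  induction hr with
  | refl => exact hu
  | tail h1 h2 ih => exact step _ _ ((SimpleGraph.reachable_iff_reflTransGen _ _).2 h1) ih h2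

theorem sum_add_sum_le_of_disjoint {V : Type*} [DecidableEq V] (a : V → ℕ) {S T U : Finset V}
    (h : Disjoint S T) (hS : S ⊆ U) (hT : T ⊆ U) : ∑ v ∈ S, a v + ∑ v ∈ T, a v ≤ ∑ v ∈ U, a v := by
  rw [← sum_union h]
  exact sum_le_sum_of_subset (union_subset hS hT)

theorem separated_union {V : Type*} [DecidableEq V] {G : SimpleGraph V}
    {S T C : Finset V}
    (hS : ∀ u ∈ S, ∀ v, v ∉ S → G.Adj u v → u ∈ C ∨ v ∈ C)
    (hT : ∀ u ∈ T, ∀ v, v ∉ T → G.Adj u v → u ∈ C ∨ v ∈ C) :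
    ∀ u ∈ S ∪ T, ∀ v, v ∉ S ∪ T → G.Adj u v → u ∈ C ∨ v ∈ C := by
  intro u hu v hv huv
  rw [mem_union, not_or] at hv
  rcases mem_union.1 hu with hu | hu
  · exact hS u hu v hv.1 huv
  · exact hT u hu v hv.2 huv

variable {V : Type*} [Fintype V] [DecidableEq V] {G : SimpleGraph V}

/-- Every edge leaving `S` ends in `z`. -/
def ExitsOnlyAt (G : SimpleGraph V) (S : Finset V) (z : V) : Prop :=
  ∀ u ∈ S, ∀ v, v ∉ S → G.Adj u v → v = z

/-- A separator of at most two vertices with both sides balanced for the weights `a` and `b`: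
the separator is `C` and the sides are `X \ C` and `Xᶜ \ C`. -/
def HasBalancedSeparator (G : SimpleGraph V) (a b : V → ℕ) : Prop :=
  ∃ X C : Finset V, C.card ≤ 2 ∧ (∀ u ∈ X, ∀ v, v ∉ X → G.Adj u v → u ∈ C ∨ v ∈ C) ∧
    3 * ∑ v ∈ X \ C, a v ≤ 2 * ∑ v, a v ∧ 3 * ∑ v ∈ Xᶜ \ C, a v ≤ 2 * ∑ v, a v ∧
    3 * ∑ v ∈ X \ C, b v ≤ 2 * ∑ v, b v ∧ 3 * ∑ v ∈ Xᶜ \ C, b v ≤ 2 * ∑ v, b v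

open Classical in
/-- The vertices on the side of `v` after deleting the edge `uv`. -/
noncomputable def branch (G : SimpleGraph V) (u v : V) : Finset V :=
  {w | (G.deleteEdges {s(u, v)}).Reachable v w}

/-- The union of the branches at `x` towards the vertices in `T`. -/
noncomputable def bundle (G : SimpleGraph V) (x : V) (T : Finset V) : Finset V :=
  T.biUnion (branch G x)

theorem mem_branch {u v w : V} :
    w ∈ branch G u v ↔ (G.deleteEdges {s(u, v)}).Reachable v w := by
  simp [branch]

theorem mem_bundle {x w : V} {T : Finset V} :
    w ∈ bundle G x T ↔ ∃ y ∈ T, w ∈ branch G x y := by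
  simp [bundle]

theorem right_mem_branch (u v : V) : v ∈ branch G u v :=
  mem_branch.2 .rfl

theorem left_notMem_branch (hG : G.IsAcyclic) {u v : V} (h : G.Adj u v) : u ∉ branch G u v := by
  rw [mem_branch]
  exact fun hr => SimpleGraph.isAcyclic_iff_forall_adj_isBridge.1 hG h hr.symm

theorem branch_exit (hG : G.IsAcyclic) {u v w w' : V} (h : G.Adj u v) (hw : w ∈ branch G u v)
    (hw' : w' ∉ branch G u v) (hadj : G.Adj w w') : w = v ∧ w' = u := by
  by_cases he : s(w, w') = s(u, v)
  · rcases Sym2.eq_iff.1 he with ⟨rfl, rfl⟩ | h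
    · exact absurd hw (left_notMem_branch hG h)
    · exact h
  · refine absurd (mem_branch.2 ((mem_branch.1 hw).trans ?_)) hw'
    exact SimpleGraph.Adj.reachable (by simp [SimpleGraph.deleteEdges_adj, hadj, he])

theorem branch_disjoint (hG : G.IsAcyclic) {x y z : V} (hy : G.Adj x y) (hz : G.Adj x z)
    (hyz : y ≠ z) : Disjoint (branch G x y) (branch G x z) := by
  rw [disjoint_right]
  intro w hw
  refine reachable_induction (p := (· ∉ branch G x y)) (mem_branch.1 hw) ?_ ?_
  · intro h
    exact hyz (branch_exit hG hy h (left_notMem_branch hG hy) hz.symm).1.symm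
  · intro p q hp hpy hpq hq
    have := (branch_exit hG hy hq hpy (SimpleGraph.deleteEdges_le _ hpq).symm).2
    rw [this] at hp
    exact left_notMem_branch hG hz (mem_branch.2 hp)

theorem mem_branch_or_swap (hG : G.IsTree) {u v : V} (h : G.Adj u v) (w : V) :
    w ∈ branch G u v ∨ w ∈ branch G v u := by
  refine reachable_induction (p := fun w => w ∈ branch G u v ∨ w ∈ branch G v u)
    (hG.connected.preconnected v w) (.inl (right_mem_branch u v)) ?_
  rintro x y - (hx | hx) hxy
  · by_cases hy : y ∈ branch G u v
    · exact .inl hy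
    · exact .inr (by rw [(branch_exit hG.isAcyclic h hx hy hxy).2]; exact right_mem_branch v u)
  · by_cases hy : y ∈ branch G v u
    · exact .inr hy
    · exact .inl (by rw [(branch_exit hG.isAcyclic h.symm hx hy hxy).2]; exact right_mem_branch u v)

theorem branch_disjoint_swap (hG : G.IsAcyclic) {u v : V} (h : G.Adj u v) :
    Disjoint (branch G u v) (branch G v u) := by
  rw [disjoint_left]
  intro w hw hw'
  rw [mem_branch] at hw hw'
  rw [Sym2.eq_swap] at hw'
  exact SimpleGraph.isAcyclic_iff_forall_adj_isBridge.1 hG h (hw'.trans hw.symm)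

theorem branch_swap_eq_compl (hG : G.IsTree) {u v : V} (h : G.Adj u v) :
    branch G v u = (branch G u v)ᶜ := by
  ext w
  have h1 := mem_branch_or_swap hG h w
  have h2 : w ∈ branch G u v → w ∉ branch G v u :=
    fun h' => disjoint_left.1 (branch_disjoint_swap hG.isAcyclic h) h'
  rw [mem_compl]
  tauto

theorem exists_mem_branch (hG : G.IsTree) {x w : V} (hw : w ≠ x) :
    ∃ y, G.Adj x y ∧ w ∈ branch G x y := by
  suffices w = x ∨ ∃ y, G.Adj x y ∧ w ∈ branch G x y from this.resolve_left hw
  refine reachable_induction (p := fun w => w = x ∨ ∃ y, G.Adj x y ∧ w ∈ branch G x y)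
    (hG.connected.preconnected x w) (.inl rfl) ?_
  rintro p q - (rfl | ⟨y, hy, hp⟩) hpq
  · exact .inr ⟨q, hpq, right_mem_branch p q⟩
  · by_cases hq : q ∈ branch G x y
    · exact .inr ⟨y, hy, hq⟩
    · exact .inl (branch_exit hG.isAcyclic hy hp hq hpq).2

theorem bundle_exitsOnlyAt (hG : G.IsAcyclic) {x : V} {T : Finset V} (hT : ∀ y ∈ T, G.Adj x y) :
    ExitsOnlyAt G (bundle G x T) x := by
  intro u hu v hv huv
  obtain ⟨y, hy, huy⟩ := mem_bundle.1 hu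
  exact (branch_exit hG (hT y hy) huy (fun h => hv (mem_bundle.2 ⟨y, hy, h⟩)) huv).2

theorem notMem_bundle (hG : G.IsAcyclic) {x : V} {T : Finset V} (hT : ∀ y ∈ T, G.Adj x y) :
    x ∉ bundle G x T := by
  intro h
  obtain ⟨y, hy, hxy⟩ := mem_bundle.1 h
  exact left_notMem_branch hG (hT y hy) hxy

theorem bundle_mono {x : V} {S T : Finset V} (h : S ⊆ T) : bundle G x S ⊆ bundle G x T :=
  biUnion_subset_biUnion_of_subset_left _ h

theorem bundle_disjoint (hG : G.IsAcyclic) {x : V} {S T : Finset V} (hS : ∀ y ∈ S, G.Adj x y)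
    (hT : ∀ y ∈ T, G.Adj x y) (h : Disjoint S T) :
    Disjoint (bundle G x S) (bundle G x T) := by
  simp only [bundle, disjoint_biUnion_left, disjoint_biUnion_right]
  intro y hy z hz
  exact branch_disjoint hG (hS z hz) (hT y hy) (fun e => disjoint_left.1 h hz (e ▸ hy))

theorem sum_bundle (hG : G.IsAcyclic) (a : V → ℕ) {x : V} {T : Finset V}
    (hT : ∀ y ∈ T, G.Adj x y) :
    ∑ v ∈ bundle G x T, a v = ∑ y ∈ T, ∑ v ∈ branch G x y, a v :=
  sum_biUnion fun _ hy _ hz hyz => branch_disjoint hG (hT _ hy) (hT _ hz) hyz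

/-- A vertex `z` with two groups of branches `P₁, P₂` at `z` inside `S` that are light even together
with an extra weight `q`, and such that the remaining vertices are light too. -/
def HasSplit (G : SimpleGraph V) (a : V → ℕ) (q : ℕ) (S : Finset V) : Prop :=
  ∃ (z : V) (P₁ P₂ : Finset V), P₁ ⊆ S ∧ P₂ ⊆ S ∧ Disjoint P₁ P₂ ∧
    ExitsOnlyAt G P₁ z ∧ ExitsOnlyAt G P₂ z ∧ ∑ v ∈ P₂, a v ≤ ∑ v ∈ P₁, a v ∧
    3 * (∑ v ∈ P₁, a v + q) ≤ 2 * ∑ v, a v ∧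
    3 * ∑ v ∈ (P₁ ∪ P₂ ∪ {z})ᶜ, a v ≤ 2 * ∑ v, a v

theorem hasSplit_bundle_of_light (hG : G.IsAcyclic) (a : V → ℕ) {q : ℕ}
    (hq : 3 * q ≤ ∑ v, a v) {z : V} {T : Finset V} (hT : ∀ y ∈ T, G.Adj z y)
    (hlight : ∀ y ∈ T, 3 * (∑ v ∈ branch G z y, a v + q) ≤ 2 * ∑ v, a v)
    (hrest : 3 * ∑ v ∈ (bundle G z T ∪ {z})ᶜ, a v ≤ 2 * ∑ v, a v) :
    HasSplit G a q (bundle G z T) := by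
  have hz : Disjoint (bundle G z T) {z} := by simpa using notMem_bundle hG hT
  have e1 := sum_add_sum_compl (bundle G z T ∪ {z}) a
  rw [sum_union hz, sum_singleton, sum_bundle hG a hT] at e1
  obtain ⟨I, J, hI, hJ, hIJ, h1, h2, h3⟩ := exists_three_bins
    (fun y => ∑ v ∈ branch G z y, a v) hq hrest T hlight (by omega)
  have hI' := fun y hy => hT y (hI hy)
  have hJ' := fun y hy => hT y (hJ hy)
  have hd := bundle_disjoint hG hI' hJ' hIJ
  have hsub := union_subset (bundle_mono (G := G) (x := z) hI) (bundle_mono (G := G) (x := z) hJ)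
  have e2 := sum_add_sum_compl (bundle G z I ∪ bundle G z J ∪ {z}) a
  rw [sum_union (disjoint_of_subset_left hsub hz), sum_union hd, sum_singleton] at e2
  simp only [← sum_bundle hG a hI', ← sum_bundle hG a hJ'] at h1 h2 h3
  rcases le_total (∑ v ∈ bundle G z J, a v) (∑ v ∈ bundle G z I, a v) with hle | hle
  · exact ⟨z, _, _, bundle_mono hI, bundle_mono hJ, hd, bundle_exitsOnlyAt hG hI',
      bundle_exitsOnlyAt hG hJ', hle, h1, by omega⟩
  · refine ⟨z, _, _, bundle_mono hJ, bundle_mono hI, hd.symm, bundle_exitsOnlyAt hG hJ',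
      bundle_exitsOnlyAt hG hI', hle, h2, ?_⟩
    rw [union_comm (bundle G z J)]
    omega

theorem HasSplit.mono {a : V → ℕ} {q : ℕ} {S S' : Finset V} (h : HasSplit G a q S)
    (hS : S ⊆ S') : HasSplit G a q S' := by
  obtain ⟨z, P₁, P₂, h1, h2, h⟩ := h
  exact ⟨z, P₁, P₂, h1.trans hS, h2.trans hS, h⟩

open Classical in
/-- The branch towards `v` consists of `v` and the branches at `v` away from `u`. -/
theorem bundle_erase_union (hG : G.IsTree) {u v : V} (h : G.Adj u v) :
    bundle G v ((univ.filter (G.Adj v)).erase u) ∪ {v} = branch G u v := by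
  ext w
  simp only [mem_union, mem_bundle, mem_erase, mem_filter, mem_univ, true_and, mem_singleton]
  constructor
  · rintro (⟨y, ⟨hyu, hy⟩, hw⟩ | rfl)
    · have := branch_swap_eq_compl hG h.symm
      rw [this, mem_compl]
      exact fun hw' => disjoint_left.1 (branch_disjoint hG.isAcyclic hy h.symm hyu) hw hw'
    · exact right_mem_branch _ _
  · intro hw
    by_cases hwv : w = v
    · exact .inr hwv
    · obtain ⟨y, hy, hwy⟩ := exists_mem_branch hG hwv
      refine .inl ⟨y, ⟨?_, hy⟩, hwy⟩
      rintro rfl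
      exact disjoint_left.1 (branch_disjoint_swap hG.isAcyclic h) hw hwy

theorem branch_ssubset (hG : G.IsTree) {u v y : V} (h : G.Adj u v) (hy : G.Adj v y)
    (hyu : y ≠ u) : branch G v y ⊂ branch G u v := by
  classical
  refine Finset.ssubset_iff_subset_ne.2 ⟨fun w hw => ?_, fun e => ?_⟩
  · rw [← bundle_erase_union hG h]
    exact mem_union_left _ (mem_bundle.2 ⟨y, by simp [hy, hyu], hw⟩)
  · exact left_notMem_branch hG.isAcyclic hy (e ▸ right_mem_branch u v)

/-- Descending from a branch with property `p` to one none of whose sub-branches has it. -/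
theorem exists_minimal_branch (hG : G.IsTree) (p : Finset V → Prop) {u v : V} (h : G.Adj u v)
    (hp : p (branch G u v)) :
    ∃ u' v', G.Adj u' v' ∧ branch G u' v' ⊆ branch G u v ∧ p (branch G u' v') ∧
      ∀ y, G.Adj v' y → y ≠ u' → ¬ p (branch G v' y) := by
  induction hn : (branch G u v).card using Nat.strong_induction_on generalizing u v with
  | _ n ih =>
    by_cases hmin : ∀ y, G.Adj v y → y ≠ u → ¬ p (branch G v y)
    · exact ⟨u, v, h, Subset.rfl, hp, hmin⟩
    · push Not at hmin
      obtain ⟨y, hy, hyu, hpy⟩ := hmin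
      have hss := branch_ssubset hG h hy hyu
      obtain ⟨u', v', h1, h2, h3⟩ := ih _ (hn ▸ card_lt_card hss) hy hpy rfl
      exact ⟨u', v', h1, h2.trans hss.subset, h3⟩

theorem hasSplit_bundle (hG : G.IsTree) (a : V → ℕ) {q : ℕ} (hq : 3 * q ≤ ∑ v, a v)
    {x : V} {T : Finset V} (hT : ∀ y ∈ T, G.Adj x y)
    (hheavy : ∑ v, a v ≤ 3 * ∑ v ∈ bundle G x T, a v) : HasSplit G a q (bundle G x T) := by
  classical
  by_cases hlight : ∀ y ∈ T, 3 * (∑ v ∈ branch G x y, a v + q) ≤ 2 * ∑ v, a v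
  · refine hasSplit_bundle_of_light hG.isAcyclic a hq hT hlight ?_
    have e1 := sum_add_sum_compl (bundle G x T) a
    have e2 := sum_le_sum_of_subset (f := a)
      (compl_subset_compl.2 (subset_union_left (s₁ := bundle G x T) (s₂ := {x})))
    omega
  · push Not at hlight
    obtain ⟨y, hy, hy2⟩ := hlight
    obtain ⟨u, z, huz, hsub, hbig, hmin⟩ := exists_minimal_branch hG
      (fun S => 2 * ∑ v, a v < 3 * (∑ v ∈ S, a v + q)) (hT y hy) hy2
    have hle : branch G x y ⊆ bundle G x T := fun w hw => mem_bundle.2 ⟨y, hy, hw⟩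
    have hbr := bundle_erase_union hG huz
    refine (hasSplit_bundle_of_light hG.isAcyclic a hq (z := z)
      (T := (univ.filter (G.Adj z)).erase u) (by simp +contextual) ?_ ?_).mono
      ((hbr ▸ subset_union_left).trans (hsub.trans hle))
    · intro w hw
      simp only [mem_erase, mem_filter, mem_univ, true_and] at hw
      exact not_lt.1 (hmin w hw.2 hw.1)
    · rw [hbr]
      have e1 := sum_add_sum_compl (branch G u z) a
      omega

/-- Two disjoint sets that admit splits for the two weights yield a balanced separator: one of four
groupings of the resulting pieces works. -/
theorem hasBalancedSeparator_of_hasSplit (a b : V → ℕ) {S T : Finset V} (hST : Disjoint S T)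
    (hS : HasSplit G a (∑ v ∈ T, a v) S) (hT : HasSplit G b (∑ v ∈ S, b v) T) :
    HasBalancedSeparator G a b := by
  obtain ⟨z, P₁, P₂, hP₁, hP₂, hP, hzP₁, hzP₂, haP, haP₁, haM⟩ := hS
  obtain ⟨w, Q₁, Q₂, hQ₁, hQ₂, hQ, hwQ₁, hwQ₂, hbQ, hbQ₁, hbM⟩ := hT
  have hPS := union_subset hP₁ hP₂
  have hQT := union_subset hQ₁ hQ₂
  have hexit {S : Finset V} {x : V} (hx : x = z ∨ x = w) (h : ExitsOnlyAt G S x) :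
      ∀ u ∈ S, ∀ v, v ∉ S → G.Adj u v → u ∈ ({z, w} : Finset V) ∨ v ∈ ({z, w} : Finset V) := by
    intro u hu v hv huv
    rw [h u hu v hv huv]
    exact .inr (by simpa using hx)
  have hS₁ := hexit (.inl rfl) hzP₁
  have hS₁₂ := separated_union hS₁ (hexit (.inl rfl) hzP₂)
  have hT₁ := hexit (.inr rfl) hwQ₁
  have hT₁₂ := separated_union hT₁ (hexit (.inr rfl) hwQ₂)
  have inside (f : V → ℕ) (X : Finset V) :
      ∑ v ∈ X \ {z, w}, f v ≤ ∑ v ∈ X, f v := sum_le_sum_of_subset sdiff_subset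
  have outside (f : V → ℕ) (X : Finset V) :
      ∑ v ∈ Xᶜ \ {z, w}, f v + ∑ v ∈ X, f v ≤ ∑ v, f v :=
    sum_add_sum_le_of_disjoint f
      (disjoint_of_subset_left sdiff_subset disjoint_compl_left) (subset_univ _) (subset_univ _)
  have rest (f : V → ℕ) {X R : Finset V} {x : V} (hx : x = z ∨ x = w) (hR : R ⊆ X) :
      ∑ v ∈ Xᶜ \ {z, w}, f v ≤ ∑ v ∈ (R ∪ {x})ᶜ, f v := by
    refine sum_le_sum_of_subset fun v hv => ?_
    simp only [mem_sdiff, mem_compl, mem_insert, mem_singleton, mem_union, not_or] at hv ⊢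
    exact ⟨fun h => hv.1 (hR h), by rcases hx with rfl | rfl <;> tauto⟩
  have split (f : V → ℕ) {R R' : Finset V} (hR : R ⊆ P₁ ∪ P₂) (hR' : R' ⊆ Q₁ ∪ Q₂) :
      ∑ v ∈ R ∪ R', f v = ∑ v ∈ R, f v + ∑ v ∈ R', f v :=
    sum_union (disjoint_of_subset_left (hR.trans hPS)
      (disjoint_of_subset_right (hR'.trans hQT) hST))
  by_contra hno
  have fails {X : Finset V} (hX : ∀ u ∈ X, ∀ v, v ∉ X → G.Adj u v →
      u ∈ ({z, w} : Finset V) ∨ v ∈ ({z, w} : Finset V)) := fun h1 h2 h3 h4 =>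
    hno ⟨X, {z, w}, card_le_two, hX, h1, h2, h3, h4⟩
  have f1 := fails (separated_union hS₁₂ hT₁₂)
  have f2 := fails (separated_union hS₁₂ hT₁)
  have f3 := fails (separated_union hS₁ hT₁₂)
  have f4 := fails (separated_union hS₁ hT₁)
  have haQ := sum_add_sum_le_of_disjoint a hQ hQ₁ hQ₂
  have hbP := sum_add_sum_le_of_disjoint b hP hP₁ hP₂
  have aP := sum_union hP (f := a)
  have bP := sum_union hP (f := b)
  have aQ := sum_union hQ (f := a)
  have bQ := sum_union hQ (f := b)
  have p1 : P₁ ⊆ P₁ ∪ P₂ := subset_union_left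
  have q1 : Q₁ ⊆ Q₁ ∪ Q₂ := subset_union_left
  have i1 := split a subset_rfl subset_rfl
  have i2 := split a subset_rfl q1
  have i3 := split a p1 subset_rfl
  have i4 := split a p1 q1
  have j1 := split b subset_rfl subset_rfl
  have j2 := split b subset_rfl q1
  have j3 := split b p1 subset_rfl
  have j4 := split b p1 q1
  have g1 : 2 * ∑ v, a v < 3 * ∑ v ∈ P₁ ∪ P₂ ∪ (Q₁ ∪ Q₂), a v ∨
      2 * ∑ v, b v < 3 * ∑ v ∈ P₁ ∪ P₂ ∪ (Q₁ ∪ Q₂), b v := by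
    by_contra! hc
    have k1 := inside a (P₁ ∪ P₂ ∪ (Q₁ ∪ Q₂))
    have k2 := inside b (P₁ ∪ P₂ ∪ (Q₁ ∪ Q₂))
    have k3 := rest a (.inl rfl) (subset_union_left (s₁ := P₁ ∪ P₂) (s₂ := Q₁ ∪ Q₂))
    have k4 := rest b (.inr rfl) (subset_union_right (s₁ := P₁ ∪ P₂) (s₂ := Q₁ ∪ Q₂))
    exact f1 (by omega) (by omega) (by omega) (by omega)
  have g2 : 2 * ∑ v, a v < 3 * ∑ v ∈ P₁ ∪ P₂ ∪ Q₁, a v ∨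
      ∑ v, b v > 3 * ∑ v ∈ P₁ ∪ P₂ ∪ Q₁, b v := by
    by_contra! hc
    have k1 := inside a (P₁ ∪ P₂ ∪ Q₁)
    have k2 := inside b (P₁ ∪ P₂ ∪ Q₁)
    have k3 := rest a (.inl rfl) (subset_union_left (s₁ := P₁ ∪ P₂) (s₂ := Q₁))
    have k4 := outside b (P₁ ∪ P₂ ∪ Q₁)
    exact f2 (by omega) (by omega) (by omega) (by omega)
  have g3 : ∑ v, a v > 3 * ∑ v ∈ P₁ ∪ (Q₁ ∪ Q₂), a v ∨
      2 * ∑ v, b v < 3 * ∑ v ∈ P₁ ∪ (Q₁ ∪ Q₂), b v := by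
    by_contra! hc
    have k1 := inside a (P₁ ∪ (Q₁ ∪ Q₂))
    have k2 := inside b (P₁ ∪ (Q₁ ∪ Q₂))
    have k3 := outside a (P₁ ∪ (Q₁ ∪ Q₂))
    have k4 := rest b (.inr rfl) (subset_union_right (s₁ := P₁) (s₂ := Q₁ ∪ Q₂))
    exact f3 (by omega) (by omega) (by omega) (by omega)
  have g4 : ∑ v, a v > 3 * ∑ v ∈ P₁ ∪ Q₁, a v ∨ ∑ v, b v > 3 * ∑ v ∈ P₁ ∪ Q₁, b v := by
    by_contra! hc
    have k1 := inside a (P₁ ∪ Q₁)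
    have k2 := inside b (P₁ ∪ Q₁)
    have k3 := outside a (P₁ ∪ Q₁)
    have k4 := outside b (P₁ ∪ Q₁)
    exact f4 (by omega) (by omega) (by omega) (by omega)
  omega

theorem hasBalancedSeparator_of_bundles (hG : G.IsTree) (a b : V → ℕ) {x x' : V}
    {T T' : Finset V} (hT : ∀ y ∈ T, G.Adj x y) (hT' : ∀ y ∈ T', G.Adj x' y)
    (hd : Disjoint (bundle G x T) (bundle G x' T'))
    (h1 : ∑ v, a v ≤ 3 * ∑ v ∈ bundle G x T, a v) (h2 : 3 * ∑ v ∈ bundle G x T, b v ≤ ∑ v, b v)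
    (h3 : ∑ v, b v ≤ 3 * ∑ v ∈ bundle G x' T', b v)
    (h4 : 3 * ∑ v ∈ bundle G x' T', a v ≤ ∑ v, a v) : HasBalancedSeparator G a b :=
  hasBalancedSeparator_of_hasSplit a b hd (hasSplit_bundle hG a h4 hT h1)
    (hasSplit_bundle hG b h2 hT' h3)

theorem hasBalancedSeparator_of_opposite_branches (hG : G.IsTree) (a b : V → ℕ) {u v : V}
    (h : G.Adj u v) (ha : 2 * ∑ w, a w < 3 * ∑ w ∈ branch G u v, a w)
    (hb : 2 * ∑ w, b w < 3 * ∑ w ∈ branch G v u, b w) : HasBalancedSeparator G a b := by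
  have e1 := sum_add_sum_compl (branch G u v) a
  have e2 := sum_add_sum_compl (branch G u v) b
  rw [← branch_swap_eq_compl hG h] at e1 e2
  have hb1 : bundle G u {v} = branch G u v := singleton_biUnion
  have hb2 : bundle G v {u} = branch G v u := singleton_biUnion
  refine hasBalancedSeparator_of_bundles hG a b (x := u) (x' := v) (T := {v}) (T' := {u})
    (by simpa using h) (by simpa using h.symm) ?_ ?_ ?_ ?_ ?_
  · rw [hb1, hb2]
    exact branch_disjoint_swap hG.isAcyclic h
  all_goals simp only [hb1, hb2]; omega

/-- Either a balanced separator exists, or some vertex is a centroid for both weights. -/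
theorem hasBalancedSeparator_or_centroid (hG : G.IsTree) (a b : V → ℕ) :
    HasBalancedSeparator G a b ∨ ∃ x, ∀ y, G.Adj x y →
      3 * ∑ v ∈ branch G x y, a v ≤ 2 * ∑ v, a v ∧ 3 * ∑ v ∈ branch G x y, b v ≤ 2 * ∑ v, b v := by
  rw [or_iff_not_imp_left]
  intro hno
  by_contra! hc
  obtain ⟨x⟩ := hG.connected.nonempty
  obtain ⟨y, hy, h⟩ := hc x
  obtain ⟨u, v, huv, -, hheavy, hmin⟩ := exists_minimal_branch hG
    (fun S => ¬ (3 * ∑ w ∈ S, a w ≤ 2 * ∑ v, a v ∧ 3 * ∑ w ∈ S, b w ≤ 2 * ∑ v, b v)) hy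
    (fun h' => absurd (h h'.1) (not_lt.2 h'.2))
  obtain ⟨y, hy, h⟩ := hc v
  by_cases hyu : y = u
  · subst hyu
    have e1 := sum_add_sum_compl (branch G y v) a
    have e2 := sum_add_sum_compl (branch G y v) b
    rw [← branch_swap_eq_compl hG huv] at e1 e2
    have o1 := fun h1 h2 => hno (hasBalancedSeparator_of_opposite_branches hG a b huv h1 h2)
    have o2 := fun h1 h2 => hno (hasBalancedSeparator_of_opposite_branches hG a b hy h1 h2)
    simp only [imp_false, not_lt] at o1 o2
    omega
  · have := hmin y hy hyu
    omega

theorem hasBalancedSeparator_of_isTree (hG : G.IsTree) (a b : V → ℕ) :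
    HasBalancedSeparator G a b := by
  classical
  rcases hasBalancedSeparator_or_centroid hG a b with h | ⟨x, hx⟩
  · exact h
  have hadj : ∀ y ∈ univ.filter (G.Adj x), G.Adj x y := by simp
  have hle (f : V → ℕ) : ∑ y ∈ univ.filter (G.Adj x), ∑ v ∈ branch G x y, f v ≤ ∑ v, f v := by
    rw [← sum_bundle hG.isAcyclic f hadj]
    exact sum_le_sum_of_subset (subset_univ _)
  rcases balanced_or_opposite (s := univ.filter (G.Adj x)) (fun y => ∑ v ∈ branch G x y, a v)
    (fun y => ∑ v ∈ branch G x y, b v) (fun y hy => (hx y (hadj y hy)).1)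
    (fun y hy => (hx y (hadj y hy)).2) (hle a) (hle b) with
    ⟨I, hI, h1, h2, h3, h4⟩ | ⟨I, J, hI, hJ, hIJ, h1, h2, h3, h4⟩
  · have hI' := fun y hy => hadj y (hI hy)
    have hI'' := fun y hy => hadj y (sdiff_subset (t := I) hy)
    have hin (f : V → ℕ) : ∑ v ∈ bundle G x I \ {x}, f v ≤ ∑ y ∈ I, ∑ v ∈ branch G x y, f v := by
      rw [← sum_bundle hG.isAcyclic f hI']
      exact sum_le_sum_of_subset sdiff_subset
    have hout (f : V → ℕ) : ∑ v ∈ (bundle G x I)ᶜ \ {x}, f v ≤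
        ∑ y ∈ univ.filter (G.Adj x) \ I, ∑ v ∈ branch G x y, f v := by
      rw [← sum_bundle hG.isAcyclic f hI'']
      refine sum_le_sum_of_subset fun w hw => ?_
      simp only [mem_sdiff, mem_compl, mem_singleton] at hw
      obtain ⟨y, hy, hwy⟩ := exists_mem_branch hG hw.2
      have hyI : y ∉ I := fun h => hw.1 (mem_bundle.2 ⟨y, h, hwy⟩)
      exact mem_bundle.2 ⟨y, by simp [hy, hyI], hwy⟩
    refine ⟨bundle G x I, {x}, by simp, fun u hu v hv huv => .inr ?_, ?_, ?_, ?_, ?_⟩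
    · simpa using bundle_exitsOnlyAt hG.isAcyclic hI' u hu v hv huv
    · have := hin a
      omega
    · have := hout a
      omega
    · have := hin b
      omega
    · have := hout b
      omega
  · have hI' := fun y hy => hadj y (hI hy)
    have hJ' := fun y hy => hadj y (hJ hy)
    rw [← sum_bundle hG.isAcyclic _ hI'] at h1 h2
    rw [← sum_bundle hG.isAcyclic _ hJ'] at h3 h4
    exact hasBalancedSeparator_of_bundles hG a b hI' hJ'
      (bundle_disjoint hG.isAcyclic hI' hJ' hIJ) h1 h2 h3 h4

end Graph

end ForestSeparator

/-- Balanced separator lemma for forests: for any forest `F = (V,E)` and any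
`V' ⊆ V` there is a partition `(A,B,C)` of `V` with `|A| ≤ 2|V|/3`,
`|B| ≤ 2|V|/3`, `|V'∩A| ≤ 2|V'|/3`, `|V'∩B| ≤ 2|V'|/3`, `|C| ≤ 2`, and every
path from a vertex of `A` to a vertex of `B` passes through a vertex of `C`. -/
theorem stmt13 {V : Type*} [Fintype V] [DecidableEq V]
    (G : SimpleGraph V) (hforest : G.IsAcyclic) (V' : Finset V) :
    ∃ A B C : Finset V,
      (∀ v : V, v ∈ A ∨ v ∈ B ∨ v ∈ C) ∧
      Disjoint A B ∧ Disjoint A C ∧ Disjoint B C ∧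
      3 * A.card ≤ 2 * Fintype.card V ∧
      3 * B.card ≤ 2 * Fintype.card V ∧
      3 * (V' ∩ A).card ≤ 2 * V'.card ∧
      3 * (V' ∩ B).card ≤ 2 * V'.card ∧
      C.card ≤ 2 ∧
      ∀ a ∈ A, ∀ b ∈ B, ∀ p : G.Walk a b, ∃ c ∈ C, c ∈ p.support := by
  rcases isEmpty_or_nonempty V with hV | hV
  · exact ⟨∅, ∅, ∅, fun v => hV.elim v, by simp, by simp, by simp, by simp, by simp, by simp,
      by simp, by simp, by simp⟩
  obtain ⟨F, hGF, hF⟩ := SimpleGraph.exists_maximal_isAcyclic_of_le_isAcyclic le_top hforest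
  have hF := (SimpleGraph.connected_top.maximal_le_isAcyclic_iff_isTree le_top).1 hF
  obtain ⟨X, C, hC, hX, h1, h2, h3, h4⟩ := ForestSeparator.hasBalancedSeparator_of_isTree hF
    (fun _ => 1) (fun v => if v ∈ V' then 1 else 0)
  simp only [sum_boole, Nat.cast_id, filter_mem_eq_inter, sum_const, smul_eq_mul, mul_one,
    card_univ, univ_inter] at h1 h2 h3 h4
  refine ⟨X \ C, Xᶜ \ C, C, fun v => ?_,
    disjoint_of_subset_left sdiff_subset
      (disjoint_of_subset_right sdiff_subset disjoint_compl_right),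
    sdiff_disjoint, sdiff_disjoint, h1, h2, by rwa [inter_comm], by rwa [inter_comm], hC, ?_⟩
  · simp only [mem_sdiff, mem_compl]
    tauto
  · intro u hu v hv p
    rw [mem_sdiff] at hu
    rw [mem_sdiff, mem_compl] at hv
    obtain ⟨d, hd, hd1, hd2⟩ := p.exists_boundary_dart (X : Set V) (by simpa using hu.1)
      (by simpa using hv.1)
    rcases hX d.fst hd1 d.snd hd2 (hGF d.adj) with h | h
    · exact ⟨_, h, p.dart_fst_mem_support_of_mem_darts hd⟩
    · exact ⟨_, h, p.dart_snd_mem_support_of_mem_darts hd⟩
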